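/- (Subdivision recurrence) Let G be a 2-connected simple graph on [N] with an edge e = uv such that deg_G(u) = 2. Then |𝔇(G:e)| = 2·|𝔇(G)| + |𝔇(G∖e)|; consequently NVol(∇^PQ_{G:e}) = 2·NVol(∇^PQ_G) + NVol(∇^PQ_{G∖e}). -/

import Mathlib

open Finset

attribute [local instance] Classical.propDecidable

/-- The set of neighbors of `i` in `G`, as a `Finset`. -/
noncomputable def nbr {N : ℕ} (G : SimpleGraph (Fin N)) (i : Fin N) : Finset (Fin N) :=
  Finset.univ.filter (fun j => G.Adj i j)

/-- `(a 1, …, a N)` is a `D(G)`-draconian sequence: the entries sum to `N - 1` and for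
every nonempty `S ⊆ [N]` one has `∑_{i ∈ S} a i < |S ∪ ⋃_{i ∈ S} N_G(i)|`. -/
def draconian {N : ℕ} (G : SimpleGraph (Fin N)) (a : Fin N → ℕ) : Prop :=
  (∑ i, a i) = N - 1 ∧
  ∀ S : Finset (Fin N), S.Nonempty →
    (∑ i ∈ S, a i) < (S ∪ S.biUnion (fun i => nbr G i)).card

/-- The subdivision `G : e` of the edge `e = uv` of `G`: the graph on `[N+1]` with edge
set `(E(G) ∖ {uv}) ∪ {u(N+1), v(N+1)}`. -/
def subdiv {N : ℕ} (G : SimpleGraph (Fin N)) (u v : Fin N) : SimpleGraph (Fin (N + 1)) :=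
  SimpleGraph.fromRel (fun i j =>
    (∃ a b : Fin N, i = a.castSucc ∧ j = b.castSucc ∧ G.Adj a b ∧
      ¬(a = u ∧ b = v) ∧ ¬(a = v ∧ b = u))
    ∨ (i = u.castSucc ∧ j = Fin.last N) ∨ (i = v.castSucc ∧ j = Fin.last N))

/-- The graph `G △ e` for an edge `e = uv` of `G`: the graph on `[N+1]` with edge set
`E(G) ∪ {u(N+1), v(N+1)}`. -/
def triExt {N : ℕ} (G : SimpleGraph (Fin N)) (u v : Fin N) : SimpleGraph (Fin (N + 1)) :=
  SimpleGraph.fromRel (fun i j =>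
    (∃ a b : Fin N, i = a.castSucc ∧ j = b.castSucc ∧ G.Adj a b)
    ∨ (i = u.castSucc ∧ j = Fin.last N) ∨ (i = v.castSucc ∧ j = Fin.last N))

/-- A graph on `[N]` is `2`-connected if it has at least `3` vertices, is connected, and
remains connected after deleting any single vertex. -/
def TwoConnected {N : ℕ} (G : SimpleGraph (Fin N)) : Prop :=
  3 ≤ N ∧ G.Connected ∧
    ∀ v : Fin N, (G.comap (fun u : {w : Fin N // w ≠ v} => (u : Fin N))).Connected

/-- The closed neighborhood `S ∪ ⋃_{i ∈ S} N_G(i)` of a set of vertices. -/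
noncomputable def closedNbr {N : ℕ} (G : SimpleGraph (Fin N)) (S : Finset (Fin N)) :
    Finset (Fin N) :=
  S ∪ S.biUnion (fun i => nbr G i)

/-- The closed neighborhood of `S` in the graph `G` with the vertex `u` removed
(for `u ∉ S`). -/
noncomputable def closedNbrErase {N : ℕ} (G : SimpleGraph (Fin N)) (u : Fin N)
    (S : Finset (Fin N)) : Finset (Fin N) :=
  (closedNbr G S).erase u

/-- The functions vanishing at `u`, with total sum `k`, whose sum over each nonempty
`T` avoiding `u` is less than `F T`. -/
def sumBounded {N : ℕ} (u : Fin N) (k : ℕ) (F : Finset (Fin N) → ℕ) : Set (Fin N → ℕ) :=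
  {b | b u = 0 ∧ ∑ i, b i = k ∧ ∀ T : Finset (Fin N), u ∉ T → T.Nonempty → ∑ i ∈ T, b i < F T}

section

variable {N : ℕ} {G : SimpleGraph (Fin N)} {u v w : Fin N}

lemma mem_closedNbr {S : Finset (Fin N)} {j : Fin N} :
    j ∈ closedNbr G S ↔ j ∈ S ∨ ∃ i ∈ S, G.Adj i j := by
  simp [closedNbr, nbr]

lemma mem_closedNbrErase {S : Finset (Fin N)} {j : Fin N} :
    j ∈ closedNbrErase G u S ↔ j ≠ u ∧ (j ∈ S ∨ ∃ i ∈ S, G.Adj i j) := by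
  simp [closedNbrErase, mem_closedNbr]

lemma draconian_iff_closedNbr {a : Fin N → ℕ} :
    draconian G a ↔ ∑ i, a i = N - 1 ∧
      ∀ S : Finset (Fin N), S.Nonempty → ∑ i ∈ S, a i < (closedNbr G S).card :=
  Iff.rfl

lemma forall_finset_iff_insert {P : Finset (Fin N) → Prop} (u : Fin N) :
    (∀ S, P S) ↔ ∀ T, u ∉ T → P T ∧ P (insert u T) := by
  refine ⟨fun h T _ => ⟨h _, h _⟩, fun h S => ?_⟩
  by_cases hu : u ∈ S
  · simpa [Finset.insert_erase hu] using (h (S.erase u) (by simp)).2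
  · exact (h S hu).1

lemma forall_finset_succ_iff {P : Finset (Fin (N + 1)) → Prop} :
    (∀ S, P S) ↔ ∀ T : Finset (Fin N), P (T.map Fin.castSuccEmb) ∧
      P (insert (Fin.last N) (T.map Fin.castSuccEmb)) := by
  refine ⟨fun h T => ⟨h _, h _⟩, fun h S => ?_⟩
  obtain ⟨T, hT⟩ : ∃ T : Finset (Fin N), S.erase (Fin.last N) = T.map Fin.castSuccEmb := by
    refine ⟨Finset.univ.filter (fun i => i.castSucc ∈ S), ?_⟩
    ext j
    induction j using Fin.lastCases <;> simp [Fin.castSucc_ne_last]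
  by_cases hS : Fin.last N ∈ S
  · simpa [← hT, Finset.insert_erase hS] using (h T).2
  · simpa [← hT, Finset.erase_eq_of_notMem hS] using (h T).1

lemma sum_update_eq_of_notMem {b : Fin N → ℕ} {p : ℕ} {T : Finset (Fin N)} (hu : u ∉ T) :
    ∑ i ∈ T, Function.update b u p i = ∑ i ∈ T, b i :=
  Finset.sum_congr rfl fun _ hi => Function.update_of_ne (ne_of_mem_of_not_mem hi hu) _ _

lemma sum_insert_update {b : Fin N → ℕ} {p : ℕ} {T : Finset (Fin N)} (hu : u ∉ T) :
    ∑ i ∈ insert u T, Function.update b u p i = ∑ i ∈ T, b i + p := by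
  rw [Finset.sum_insert hu, sum_update_eq_of_notMem hu, Function.update_self, add_comm]

lemma sum_univ_update {b : Fin N → ℕ} {p : ℕ} (hb : b u = 0) :
    ∑ i, Function.update b u p i = ∑ i, b i + p := by
  have h := sum_insert_update (b := b) (p := p) (Finset.notMem_erase u Finset.univ)
  rw [Finset.insert_erase (Finset.mem_univ u)] at h
  rw [h, ← Finset.add_sum_erase _ _ (Finset.mem_univ u), hb, zero_add]

lemma closedNbr_card_of_notMem {T : Finset (Fin N)} (hN : nbr G u = {v, w}) (hT : u ∉ T) :
    (closedNbr G T).card = (closedNbrErase G u T).card + if v ∈ T ∨ w ∈ T then 1 else 0 := by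
  have hadj : ∀ i, G.Adj i u ↔ i = v ∨ i = w := fun i => by
    rw [G.adj_comm]; simpa [nbr] using Finset.ext_iff.1 hN i
  have hmem : u ∈ closedNbr G T ↔ v ∈ T ∨ w ∈ T := by
    simp [mem_closedNbr, hT, hadj]; aesop
  simp only [closedNbrErase, Finset.card_erase_eq_ite, ← hmem]
  split_ifs with h
  · have := Finset.card_pos.2 ⟨u, h⟩
    omega
  · rfl

lemma closedNbr_insert {T : Finset (Fin N)} (hN : nbr G u = {v, w}) :
    (closedNbr G (insert u T)).card = (insert v (insert w (closedNbrErase G u T))).card + 1 := by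
  have hadj : ∀ i, G.Adj u i ↔ i = v ∨ i = w := fun i => by
    simpa [nbr] using Finset.ext_iff.1 hN i
  have hv : u ≠ v := ((hadj v).2 (.inl rfl)).ne
  have hw : u ≠ w := ((hadj w).2 (.inr rfl)).ne
  rw [← Finset.card_insert_of_notMem (a := u) (by simp [mem_closedNbrErase, hv, hw])]
  congr 1
  ext j
  simp only [mem_closedNbr, Finset.mem_insert, mem_closedNbrErase, exists_eq_or_imp, hadj]
  tauto

lemma draconian_update_iff (hN : nbr G u = {v, w}) {b : Fin N → ℕ} (hb : b u = 0) (p : ℕ) :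
    draconian G (Function.update b u p) ↔ ∑ i, b i + p = N - 1 ∧
      ∀ T : Finset (Fin N), u ∉ T →
        (T.Nonempty → ∑ i ∈ T, b i <
          (closedNbrErase G u T).card + if v ∈ T ∨ w ∈ T then 1 else 0) ∧
        ∑ i ∈ T, b i + p < (insert v (insert w (closedNbrErase G u T))).card + 1 := by
  rw [draconian_iff_closedNbr, sum_univ_update hb, forall_finset_iff_insert u]
  refine and_congr_right fun _ => forall_congr' fun T => forall_congr' fun hT => ?_
  rw [sum_update_eq_of_notMem hT, sum_insert_update hT, closedNbr_card_of_notMem hN hT,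
    closedNbr_insert hN]
  simp

lemma subdiv_adj_castSucc {i j : Fin N} :
    (subdiv G u v).Adj i.castSucc j.castSucc ↔
      G.Adj i j ∧ ¬(i = u ∧ j = v) ∧ ¬(i = v ∧ j = u) := by
  simp only [subdiv, SimpleGraph.fromRel_adj, Fin.castSucc_inj, Fin.castSucc_ne_last, ne_eq]
  constructor
  · rintro ⟨-, (⟨a, b, rfl, rfl, h⟩ | h) | (⟨a, b, rfl, rfl, h⟩ | h)⟩
    · exact h
    · simp at h
    · exact ⟨h.1.symm, by tauto⟩
    · simp at h
  · exact fun h => ⟨h.1.ne, .inl (.inl ⟨i, j, rfl, rfl, h⟩)⟩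

lemma subdiv_adj_last {i : Fin N} :
    (subdiv G u v).Adj i.castSucc (Fin.last N) ↔ i = u ∨ i = v := by
  simp only [subdiv, SimpleGraph.fromRel_adj, Fin.castSucc_inj, Fin.castSucc_ne_last, ne_eq,
    (Fin.castSucc_ne_last _).symm]
  simp

lemma subdiv_last_adj {i : Fin N} :
    (subdiv G u v).Adj (Fin.last N) i.castSucc ↔ i = u ∨ i = v := by
  rw [SimpleGraph.adj_comm, subdiv_adj_last]

lemma mem_closedNbr_subdiv_castSucc {T : Finset (Fin N)} {j : Fin N} :
    j.castSucc ∈ closedNbr (subdiv G u v) (T.map Fin.castSuccEmb) ↔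
      j ∈ T ∨ ∃ i ∈ T, G.Adj i j ∧ ¬(i = u ∧ j = v) ∧ ¬(i = v ∧ j = u) := by
  simp [mem_closedNbr, subdiv_adj_castSucc]

lemma last_mem_closedNbr_subdiv {T : Finset (Fin N)} :
    Fin.last N ∈ closedNbr (subdiv G u v) (T.map Fin.castSuccEmb) ↔ u ∈ T ∨ v ∈ T := by
  simp [mem_closedNbr, subdiv_adj_last]; aesop

lemma closedNbr_insert_eq {S : Finset (Fin N)} {x : Fin N} :
    closedNbr G (insert x S) = insert x (nbr G x) ∪ closedNbr G S := by
  ext j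
  simp only [mem_closedNbr, Finset.mem_insert, Finset.mem_union, exists_eq_or_imp, nbr,
    Finset.mem_filter, Finset.mem_univ, true_and]
  tauto

lemma card_eq_of_mem_iff {A : Finset (Fin (N + 1))} {B : Finset (Fin N)} {P Q : Prop}
    [Decidable P] [Decidable Q] (hB : ∀ j ≠ u, j.castSucc ∈ A ↔ j ∈ B) (huB : u ∉ B) (hu : u.castSucc ∈ A ↔ P)
    (hl : Fin.last N ∈ A ↔ Q) :
    A.card = B.card + (if P then 1 else 0) + if Q then 1 else 0 := by
  have hA : A = (B.map Fin.castSuccEmb ∪ if P then {u.castSucc} else ∅) ∪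
      if Q then {Fin.last N} else ∅ := by
    ext j
    induction j using Fin.lastCases with
    | last => by_cases hQ : Q <;> by_cases hP : P <;> simp [hl, hQ, hP, (Fin.castSucc_ne_last _).symm]
    | cast j =>
      by_cases hj : j = u
      · subst hj
        by_cases hQ : Q <;> by_cases hP : P <;> simp [hu, hQ, hP, huB, Fin.castSucc_ne_last]
      · by_cases hQ : Q <;> by_cases hP : P <;> simp [hB j hj, hQ, hP, hj, Fin.castSucc_ne_last]
  rw [hA, Finset.card_union_of_disjoint, Finset.card_union_of_disjoint, Finset.card_map]
  · by_cases hQ : Q <;> by_cases hP : P <;> simp [hQ, hP]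
  · by_cases hP : P <;> simp [hP, huB]
  · by_cases hQ : Q <;> by_cases hP : P <;> simp [hQ, hP, (Fin.castSucc_ne_last _).symm]

lemma mem_closedNbr_subdiv_iff {T : Finset (Fin N)} (hT : u ∉ T) {j : Fin N} (hj : j ≠ u) :
    j.castSucc ∈ closedNbr (subdiv G u v) (T.map Fin.castSuccEmb) ↔
      j ∈ closedNbrErase G u T := by
  rw [mem_closedNbr_subdiv_castSucc, mem_closedNbrErase]
  simp only [hj, and_false, not_false_eq_true, and_true, ne_eq, true_and]
  refine or_congr_right (exists_congr fun i => and_congr_right fun hi => ?_)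
  simp [ne_of_mem_of_not_mem hi hT]

lemma closedNbr_subdiv_card (hN : ∀ i, G.Adj u i ↔ i = v ∨ i = w) (hvw : v ≠ w)
    {T : Finset (Fin N)} (hT : u ∉ T) :
    (closedNbr (subdiv G u v) (T.map Fin.castSuccEmb)).card =
      (closedNbrErase G u T).card + (if w ∈ T then 1 else 0) + if v ∈ T then 1 else 0 := by
  have hN' : ∀ i, G.Adj i u ↔ i = v ∨ i = w := fun i => by rw [G.adj_comm, hN]
  have hv : u ≠ v := ((hN v).2 (.inl rfl)).ne
  refine card_eq_of_mem_iff (fun j hj => mem_closedNbr_subdiv_iff hT hj)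
    (by simp [mem_closedNbrErase]) ?_ ?_
  · rw [mem_closedNbr_subdiv_castSucc]
    simp only [hT, hN', hv, and_false, and_true, false_or, not_false_eq_true, true_and]
    constructor
    · rintro ⟨i, hi, rfl | rfl, h⟩
      · exact absurd rfl h
      · exact hi
    · exact fun h => ⟨w, h, .inr rfl, hvw.symm⟩
  · simp [last_mem_closedNbr_subdiv, hT]

lemma mem_nbr_subdiv_left (hN : ∀ i, G.Adj u i ↔ i = v ∨ i = w) (hvw : v ≠ w) {j : Fin N} :
    j.castSucc ∈ nbr (subdiv G u v) u.castSucc ↔ j = w := by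
  have hv : u ≠ v := ((hN v).2 (.inl rfl)).ne
  simp only [nbr, Finset.mem_filter, Finset.mem_univ, true_and, subdiv_adj_castSucc, hN, hv,
    false_and, not_false_eq_true, and_true]
  constructor
  · tauto
  · rintro rfl
    exact ⟨.inr rfl, hvw.symm⟩

lemma last_mem_nbr_subdiv_left :
    Fin.last N ∈ nbr (subdiv G u v) u.castSucc := by
  simp [nbr, subdiv_adj_last]

lemma mem_nbr_subdiv_last {j : Fin N} :
    j.castSucc ∈ nbr (subdiv G u v) (Fin.last N) ↔ j = u ∨ j = v := by
  simp [nbr, subdiv_last_adj]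

lemma closedNbr_subdiv_insert_left_card (hN : ∀ i, G.Adj u i ↔ i = v ∨ i = w) (hvw : v ≠ w)
    {T : Finset (Fin N)} (hT : u ∉ T) :
    (closedNbr (subdiv G u v) ((insert u T).map Fin.castSuccEmb)).card =
      (insert w (closedNbrErase G u T)).card + 2 := by
  have hw : u ≠ w := ((hN w).2 (.inr rfl)).ne
  rw [Finset.map_insert, closedNbr_insert_eq, card_eq_of_mem_iff (u := u) (P := True) (Q := True)
    (B := insert w (closedNbrErase G u T))]
  · simp
  · intro j hj
    simp [mem_closedNbr_subdiv_iff hT hj, mem_nbr_subdiv_left hN hvw, hj]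
  · simp [mem_closedNbrErase, hw]
  · simp
  · simp [last_mem_nbr_subdiv_left]

lemma closedNbr_subdiv_insert_last_card (hN : ∀ i, G.Adj u i ↔ i = v ∨ i = w)
    {T : Finset (Fin N)} (hT : u ∉ T) :
    (closedNbr (subdiv G u v) (insert (Fin.last N) (T.map Fin.castSuccEmb))).card =
      (insert v (closedNbrErase G u T)).card + 2 := by
  have hv : u ≠ v := ((hN v).2 (.inl rfl)).ne
  rw [closedNbr_insert_eq, card_eq_of_mem_iff (u := u) (P := True) (Q := True)
    (B := insert v (closedNbrErase G u T))]
  · simp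
  · intro j hj
    simp [mem_closedNbr_subdiv_iff hT hj, mem_nbr_subdiv_last, hj, Fin.castSucc_ne_last]
  · simp [mem_closedNbrErase, hv]
  · simp [mem_nbr_subdiv_last]
  · simp

lemma closedNbr_subdiv_insert_both_card (hN : ∀ i, G.Adj u i ↔ i = v ∨ i = w) (hvw : v ≠ w)
    {T : Finset (Fin N)} (hT : u ∉ T) :
    (closedNbr (subdiv G u v)
      (insert (Fin.last N) ((insert u T).map Fin.castSuccEmb))).card =
      (insert v (insert w (closedNbrErase G u T))).card + 2 := by
  have hv : u ≠ v := ((hN v).2 (.inl rfl)).ne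
  have hw : u ≠ w := ((hN w).2 (.inr rfl)).ne
  rw [Finset.map_insert, closedNbr_insert_eq, closedNbr_insert_eq,
    card_eq_of_mem_iff (u := u) (P := True) (Q := True)
    (B := insert v (insert w (closedNbrErase G u T)))]
  · simp
  · intro j hj
    simp [mem_closedNbr_subdiv_iff hT hj, mem_nbr_subdiv_last, mem_nbr_subdiv_left hN hvw, hj,
      Fin.castSucc_ne_last]
  · simp [mem_closedNbrErase, hv, hw]
  · simp
  · simp

lemma sum_map_snoc {b : Fin N → ℕ} {q : ℕ} (T : Finset (Fin N)) :
    ∑ i ∈ T.map Fin.castSuccEmb, (Fin.snoc b q : Fin (N + 1) → ℕ) i = ∑ i ∈ T, b i := by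
  simp

lemma sum_insert_last_snoc {b : Fin N → ℕ} {q : ℕ} (T : Finset (Fin N)) :
    ∑ i ∈ insert (Fin.last N) (T.map Fin.castSuccEmb), (Fin.snoc b q : Fin (N + 1) → ℕ) i =
      ∑ i ∈ T, b i + q := by
  rw [Finset.sum_insert (by simp [Fin.castSucc_ne_last]), sum_map_snoc, Fin.snoc_last, add_comm]

lemma draconian_subdiv_snoc_update_iff (hN : ∀ i, G.Adj u i ↔ i = v ∨ i = w) (hvw : v ≠ w)
    {b : Fin N → ℕ} (hb : b u = 0) (p q : ℕ) :
    draconian (subdiv G u v) (Fin.snoc (Function.update b u p) q) ↔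
      ∑ i, b i + p + q = N ∧ ∀ T : Finset (Fin N), u ∉ T →
        (T.Nonempty → ∑ i ∈ T, b i < (closedNbrErase G u T).card +
          (if w ∈ T then 1 else 0) + if v ∈ T then 1 else 0) ∧
        ∑ i ∈ T, b i + p < (insert w (closedNbrErase G u T)).card + 2 ∧
        ∑ i ∈ T, b i + q < (insert v (closedNbrErase G u T)).card + 2 ∧
        ∑ i ∈ T, b i + p + q < (insert v (insert w (closedNbrErase G u T))).card + 2 := by
  rw [draconian_iff_closedNbr, Fin.sum_univ_castSucc, forall_finset_succ_iff,
    forall_finset_iff_insert u]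
  simp only [Fin.snoc_castSucc, Fin.snoc_last, sum_univ_update hb, Nat.add_sub_cancel]
  refine and_congr_right fun _ => forall_congr' fun T => forall_congr' fun hT => ?_
  rw [sum_map_snoc, sum_map_snoc, sum_insert_last_snoc, sum_insert_last_snoc,
    sum_update_eq_of_notMem hT, sum_insert_update hT, closedNbr_subdiv_card hN hvw hT,
    closedNbr_subdiv_insert_left_card hN hvw hT, closedNbr_subdiv_insert_last_card hN hT,
    closedNbr_subdiv_insert_both_card hN hvw hT]
  simp only [Finset.map_nonempty, Finset.insert_nonempty, forall_const]
  tauto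

lemma finite_setOf_draconian (G : SimpleGraph (Fin N)) : {a | draconian G a}.Finite := by
  refine (Set.finite_Iic (fun _ : Fin N => N - 1)).subset fun a ha i => ?_
  rw [← ha.1]
  exact Finset.single_le_sum (f := a) (fun _ _ => Nat.zero_le _) (Finset.mem_univ i)

lemma ncard_eq_sum_ncard_fiber {α : Type*} {S : Set α} (hS : S.Finite) (f : α → ℕ) (m : ℕ)
    (hf : ∀ a ∈ S, f a < m) :
    S.ncard = ∑ p ∈ Finset.range m, {a ∈ S | f a = p}.ncard := by
  lift S to Finset α using hS
  rw [Set.ncard_coe_finset, Finset.card_eq_sum_card_fiberwise (f := f) (t := Finset.range m)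
    fun a ha => by simpa using hf a ha]
  refine Finset.sum_congr rfl fun p _ => ?_
  rw [← Set.ncard_coe_finset]
  simp

lemma ncard_eq_sum_ncard_update {S : Set (Fin N → ℕ)} (hS : S.Finite) (u : Fin N) (m : ℕ)
    (hm : ∀ a ∈ S, a u < m) :
    S.ncard = ∑ p ∈ Finset.range m, {b | b u = 0 ∧ Function.update b u p ∈ S}.ncard := by
  rw [ncard_eq_sum_ncard_fiber hS (fun a => a u) m hm]
  refine Finset.sum_congr rfl fun p _ => ?_
  refine Set.ncard_congr (fun a _ => Function.update a u 0) ?_ ?_ ?_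
  · rintro a ⟨ha, rfl⟩
    simpa using ha
  · rintro a a' ⟨-, h⟩ ⟨-, h'⟩ heq
    funext i
    by_cases hi : i = u
    · subst hi
      exact h.trans h'.symm
    · simpa [hi] using congrFun heq i
  · rintro b ⟨hb, hS⟩
    refine ⟨Function.update b u p, ⟨hS, by simp⟩, ?_⟩
    simp [← hb]

lemma ncard_eq_sum_ncard_snoc {S : Set (Fin (N + 1) → ℕ)} (hS : S.Finite) (m : ℕ)
    (hm : ∀ a ∈ S, a (Fin.last N) < m) :
    S.ncard = ∑ q ∈ Finset.range m, {b : Fin N → ℕ | Fin.snoc b q ∈ S}.ncard := by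
  rw [ncard_eq_sum_ncard_fiber hS (fun a => a (Fin.last N)) m hm]
  refine Finset.sum_congr rfl fun q _ => ?_
  refine (Set.ncard_congr (fun (b : Fin N → ℕ) _ => (Fin.snoc b q : Fin (N + 1) → ℕ))
    ?_ ?_ ?_).symm
  · intro b hb
    exact ⟨hb, by simp⟩
  · intro b b' _ _ h
    exact (Fin.snoc_inj.1 h).1
  · rintro a ⟨ha, rfl⟩
    exact ⟨Fin.init a, by simpa using ha, by simp⟩

lemma sum_add_single {b : Fin N → ℕ} {T : Finset (Fin N)} :
    ∑ i ∈ T, (b + Pi.single w 1 : Fin N → ℕ) i = ∑ i ∈ T, b i + if w ∈ T then 1 else 0 := by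
  simp [Finset.sum_add_distrib, Finset.sum_pi_single']

lemma ncard_sumBounded_add_ite (hw : w ≠ u) (k : ℕ) (F : Finset (Fin N) → ℕ)
    (hne : ∃ v, v ≠ u ∧ v ≠ w) (hF : F ((Finset.univ.erase u).erase w) ≤ k + 1) :
    (sumBounded u (k + 1) fun T => F T + if w ∈ T then 1 else 0).ncard =
      (sumBounded u k F).ncard := by
  have himg : (sumBounded u (k + 1) fun T => F T + if w ∈ T then 1 else 0) =
      (fun b => b + Pi.single w 1) '' sumBounded u k F := by
    ext b
    constructor
    · rintro ⟨hu, hk, hT⟩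
      have hbw : b w ≠ 0 := by
        intro hbw
        obtain ⟨v, hvu, hvw⟩ := hne
        have h := hT ((Finset.univ.erase u).erase w) (by simp) ⟨v, by simp [hvu, hvw]⟩
        rw [Finset.sum_erase _ hbw, Finset.sum_erase _ hu, hk] at h
        simp at h
        omega
      obtain ⟨c, rfl⟩ : ∃ c, c + Pi.single w 1 = b :=
        ⟨b - Pi.single w 1, by
          funext i
          by_cases hi : i = w
          · subst hi
            simp
            omega
          · simp [hi]⟩
      refine ⟨c, ⟨by simpa [hw.symm] using hu, ?_, fun T huT hTn => ?_⟩, rfl⟩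
      · rw [sum_add_single] at hk
        simpa using hk
      · have h := hT T huT hTn
        rw [sum_add_single] at h
        exact Nat.add_lt_add_iff_right.1 h
    · rintro ⟨c, ⟨hu, hk, hT⟩, rfl⟩
      refine ⟨by simp [hu, hw.symm], by rw [sum_add_single]; simp [hk], fun T huT hTn => ?_⟩
      rw [sum_add_single]
      exact Nat.add_lt_add_right (hT T huT hTn) _
  rw [himg, Set.ncard_image_of_injective _ (add_left_injective _)]

lemma mem_closedNbrErase_of_mem {T : Finset (Fin N)} (hT : u ∉ T) {x : Fin N} (hx : x ∈ T) :
    x ∈ closedNbrErase G u T :=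
  mem_closedNbrErase.2 ⟨ne_of_mem_of_not_mem hx hT, .inl hx⟩

lemma card_closedNbrErase_le (T : Finset (Fin N)) : (closedNbrErase G u T).card ≤ N - 1 := by
  have h : closedNbrErase G u T ⊆ Finset.univ.erase u :=
    Finset.erase_subset_erase _ (Finset.subset_univ _)
  simpa using Finset.card_le_card h

lemma closedNbrErase_deleteEdges {T : Finset (Fin N)} (hT : u ∉ T) :
    closedNbrErase (G.deleteEdges {s(u, v)}) u T = closedNbrErase G u T := by
  ext j
  simp only [mem_closedNbrErase, SimpleGraph.deleteEdges_adj, Set.mem_singleton_iff]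
  refine and_congr_right fun hj => or_congr_right <| exists_congr fun i =>
    and_congr_right fun hi => ?_
  simp [ne_of_mem_of_not_mem hi hT, hj]

lemma nbr_deleteEdges (hN : nbr G u = {v, w}) (hvw : v ≠ w) :
    nbr (G.deleteEdges {s(u, v)}) u = {w, w} := by
  ext j
  have h := Finset.ext_iff.1 hN j
  simp only [nbr, Finset.mem_filter, Finset.mem_univ, true_and, Finset.mem_insert,
    Finset.mem_singleton] at h
  simp only [nbr, Finset.mem_filter, Finset.mem_univ, true_and, SimpleGraph.deleteEdges_adj,
    Set.mem_singleton_iff, h, Sym2.congr_right]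
  grind

/-- Closed neighborhoods are submodular. -/
lemma card_closedNbrErase_union_add_inter_le (S T : Finset (Fin N)) :
    (closedNbrErase G u (S ∪ T)).card + (closedNbrErase G u (S ∩ T)).card ≤
      (closedNbrErase G u S).card + (closedNbrErase G u T).card := by
  have h1 : closedNbrErase G u (S ∪ T) = closedNbrErase G u S ∪ closedNbrErase G u T := by
    ext j
    simp only [mem_closedNbrErase, Finset.mem_union]
    grind
  have h2 : closedNbrErase G u (S ∩ T) ⊆ closedNbrErase G u S ∩ closedNbrErase G u T := by
    intro j
    simp only [mem_closedNbrErase, Finset.mem_inter]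
    grind
  have h3 := Finset.card_union_add_card_inter (closedNbrErase G u S) (closedNbrErase G u T)
  have h4 := Finset.card_le_card h2
  rw [h1]
  omega

lemma exists_card_insert_closedNbrErase (hvw : v ≠ w) {T : Finset (Fin N)} (hT : u ∉ T) :
    ∃ s t : ℕ, s ≤ 1 ∧ t ≤ 1 ∧ (v ∈ T → s = 0) ∧ (w ∈ T → t = 0) ∧
      (insert v (closedNbrErase G u T)).card = (closedNbrErase G u T).card + s ∧
      (insert w (closedNbrErase G u T)).card = (closedNbrErase G u T).card + t ∧
      (insert v (insert w (closedNbrErase G u T))).card =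
        (closedNbrErase G u T).card + s + t := by
  refine ⟨if v ∈ closedNbrErase G u T then 0 else 1, if w ∈ closedNbrErase G u T then 0 else 1,
    by split_ifs <;> simp, by split_ifs <;> simp,
    fun h => by simp [mem_closedNbrErase_of_mem hT h],
    fun h => by simp [mem_closedNbrErase_of_mem hT h], ?_, ?_, ?_⟩ <;>
  by_cases h1 : v ∈ closedNbrErase G u T <;> by_cases h2 : w ∈ closedNbrErase G u T <;>
  simp [h1, h2, hvw]

lemma closedNbrErase_empty : closedNbrErase G u ∅ = ∅ := by
  ext j
  simp [mem_closedNbrErase]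

lemma subdiv_fiber_eq_fiber (h3 : 3 ≤ N) (hN : nbr G u = {v, w}) (hvw : v ≠ w) {p q r : ℕ}
    (hpqr : p + q = r + 1 ∧ p ≤ 2 ∧ q ≤ 2 ∧ r ≤ 2) (h02 : p ≠ 0 ∨ q ≠ 2) (h20 : p ≠ 2 ∨ q ≠ 0) :
    {b : Fin N → ℕ | b u = 0 ∧
      draconian (subdiv G u v) (Fin.snoc (Function.update b u p) q)} =
    {b | b u = 0 ∧ draconian G (Function.update b u r)} := by
  have hadj : ∀ i, G.Adj u i ↔ i = v ∨ i = w := fun i => by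
    simpa [nbr] using Finset.ext_iff.1 hN i
  ext b
  refine and_congr_right fun hb => ?_
  rw [draconian_subdiv_snoc_update_iff hadj hvw hb, draconian_update_iff hN hb]
  refine and_congr (by omega) (forall_congr' fun T => forall_congr' fun hT => ?_)
  obtain ⟨s, t, hs, ht, hsT, htT, h1, h2, h3⟩ :=
    exists_card_insert_closedNbrErase (G := G) hvw hT
  rcases T.eq_empty_or_nonempty with rfl | hTn
  · simp [closedNbrErase_empty, Finset.card_pair hvw]
    omega
  · by_cases hv : v ∈ T <;> by_cases hw : w ∈ T <;>
      simp only [h1, h2, h3, hv, hw, hTn, true_or, or_true, or_self, if_true, if_false,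
        forall_const] at hsT htT ⊢ <;>
      omega

lemma subdiv_fiber_zero_zero (h3 : 3 ≤ N) (hN : nbr G u = {v, w}) (hvw : v ≠ w) :
    {b : Fin N → ℕ | b u = 0 ∧
      draconian (subdiv G u v) (Fin.snoc (Function.update b u 0) 0)} =
    sumBounded u (N - 2 + 1 + 1) fun T =>
      ((closedNbrErase G u T).card + if v ∈ T then 1 else 0) + if w ∈ T then 1 else 0 := by
  have hadj : ∀ i, G.Adj u i ↔ i = v ∨ i = w := fun i => by
    simpa [nbr] using Finset.ext_iff.1 hN i
  ext b
  refine and_congr_right fun hb => ?_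
  rw [draconian_subdiv_snoc_update_iff hadj hvw hb]
  refine and_congr (by omega) (forall_congr' fun T => forall_congr' fun hT => ?_)
  obtain ⟨s, t, hs, ht, hsT, htT, h1, h2, h3⟩ :=
    exists_card_insert_closedNbrErase (G := G) hvw hT
  rcases T.eq_empty_or_nonempty with rfl | hTn
  · simp
  · by_cases hv : v ∈ T <;> by_cases hw : w ∈ T <;>
      simp only [h1, h2, h3, hv, hw, hTn, if_true, if_false, forall_const] at hsT htT ⊢ <;>
      omega

lemma subdiv_fiber_two_two (hN : nbr G u = {v, w}) (hvw : v ≠ w) :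
    {b : Fin N → ℕ | b u = 0 ∧
      draconian (subdiv G u v) (Fin.snoc (Function.update b u 2) 2)} = ∅ := by
  have hadj : ∀ i, G.Adj u i ↔ i = v ∨ i = w := fun i => by
    simpa [nbr] using Finset.ext_iff.1 hN i
  rw [Set.eq_empty_iff_forall_notMem]
  rintro b ⟨hb, h⟩
  rw [draconian_subdiv_snoc_update_iff hadj hvw hb] at h
  have := (h.2 ∅ (by simp)).2.2.2
  simp [closedNbrErase_empty, Finset.card_pair hvw] at this

lemma subdiv_fiber_union (h3 : 3 ≤ N) (hN : nbr G u = {v, w}) (hvw : v ≠ w) :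
    {b : Fin N → ℕ | b u = 0 ∧
      draconian (subdiv G u v) (Fin.snoc (Function.update b u 0) 2)} ∪
    {b : Fin N → ℕ | b u = 0 ∧
      draconian (subdiv G u v) (Fin.snoc (Function.update b u 2) 0)} =
    {b | b u = 0 ∧ draconian G (Function.update b u 1)} := by
  have hadj : ∀ i, G.Adj u i ↔ i = v ∨ i = w := fun i => by
    simpa [nbr] using Finset.ext_iff.1 hN i
  ext b
  rw [Set.mem_union, Set.mem_ofPred, Set.mem_ofPred, Set.mem_ofPred, ← and_or_left]
  refine and_congr_right fun hb => ?_
  rw [draconian_subdiv_snoc_update_iff hadj hvw hb, draconian_subdiv_snoc_update_iff hadj hvw hb,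
    draconian_update_iff hN hb]
  constructor
  · have key : ∀ T : Finset (Fin N), u ∉ T → _ := fun T hT =>
      exists_card_insert_closedNbrErase (G := G) hvw hT
    rintro (⟨hs, h⟩ | ⟨hs, h⟩) <;> refine ⟨by omega, fun T hT => ?_⟩ <;>
      have h := h T hT <;>
      obtain ⟨s, t, hs, ht, hsT, htT, h1, h2, h3⟩ := key T hT <;>
      rcases T.eq_empty_or_nonempty with rfl | hTn <;>
      first
      | simp [closedNbrErase_empty, Finset.card_pair hvw]; done
      | by_cases hv : v ∈ T <;> by_cases hw : w ∈ T <;>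
        simp only [h1, h2, h3, hv, hw, hTn, true_or, or_true, or_self, if_true, if_false,
          forall_const] at h hsT htT ⊢ <;>
        omega
  · rintro ⟨hs, h⟩
    by_contra hcon
    rw [not_or, not_and, not_and] at hcon
    obtain ⟨hcon1, hcon2⟩ := hcon
    replace hcon1 := hcon1 (by omega)
    replace hcon2 := hcon2 (by omega)
    rw [not_forall] at hcon1 hcon2
    obtain ⟨S, hcon1⟩ := hcon1
    obtain ⟨hS, hcon1⟩ := not_forall.1 hcon1
    obtain ⟨T, hcon2⟩ := hcon2
    obtain ⟨hT, hcon2⟩ := not_forall.1 hcon2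
    have hS' : v ∈ S ∧ w ∉ S ∧ ∑ i ∈ S, b i = (closedNbrErase G u S).card := by
      have h := h S hS
      obtain ⟨s, t, hs, ht, hsT, htT, h1, h2, h3⟩ :=
        exists_card_insert_closedNbrErase (G := G) hvw hS
      rcases S.eq_empty_or_nonempty with rfl | hTn
      · simp [closedNbrErase_empty, Finset.card_pair hvw] at hcon1
      · by_cases hv : v ∈ S <;> by_cases hw : w ∈ S <;>
          simp only [h1, h2, h3, hv, hw, hTn, true_or, or_true, or_self, if_true, if_false,
            forall_const] at h hcon1 hsT htT ⊢ <;>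
          simp <;> omega
    have hT' : w ∈ T ∧ v ∉ T ∧ ∑ i ∈ T, b i = (closedNbrErase G u T).card := by
      have h := h T hT
      obtain ⟨s, t, hs, ht, hsT, htT, h1, h2, h3⟩ :=
        exists_card_insert_closedNbrErase (G := G) hvw hT
      rcases T.eq_empty_or_nonempty with rfl | hTn
      · simp [closedNbrErase_empty, Finset.card_pair hvw] at hcon2
      · by_cases hv : v ∈ T <;> by_cases hw : w ∈ T <;>
          simp only [h1, h2, h3, hv, hw, hTn, true_or, or_true, or_self, if_true, if_false,
            forall_const] at h hcon2 hsT htT ⊢ <;>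
          simp <;> omega
    have hsub := card_closedNbrErase_union_add_inter_le (G := G) (u := u) S T
    have hsum := Finset.sum_union_inter (s₁ := S) (s₂ := T) (f := b)
    have hun := (h (S ∪ T) (by simp [hS, hT])).2
    rw [Finset.insert_eq_self.2, Finset.insert_eq_self.2] at hun
    · have hint : ∑ i ∈ S ∩ T, b i ≤ (closedNbrErase G u (S ∩ T)).card := by
        rcases (S ∩ T).eq_empty_or_nonempty with h0 | h0
        · simp [h0]
        · have := (h (S ∩ T) (by simp [hS])).1 h0
          simp [hS', hT'] at this
          omega
      omega
    · exact mem_closedNbrErase_of_mem (by simp [hS, hT]) (by simp [hT'])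
    · rw [Finset.insert_eq_self.2] <;>
      exact mem_closedNbrErase_of_mem (by simp [hS, hT]) (by simp [hS', hT'])

lemma subdiv_fiber_inter (h3 : 3 ≤ N) (hN : nbr G u = {v, w}) (hvw : v ≠ w) :
    {b : Fin N → ℕ | b u = 0 ∧
      draconian (subdiv G u v) (Fin.snoc (Function.update b u 0) 2)} ∩
    {b : Fin N → ℕ | b u = 0 ∧
      draconian (subdiv G u v) (Fin.snoc (Function.update b u 2) 0)} =
    sumBounded u (N - 2) fun T => (closedNbrErase G u T).card := by
  have hadj : ∀ i, G.Adj u i ↔ i = v ∨ i = w := fun i => by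
    simpa [nbr] using Finset.ext_iff.1 hN i
  ext b
  rw [Set.mem_inter_iff, Set.mem_ofPred, Set.mem_ofPred, ← and_and_left]
  refine and_congr_right fun hb => ?_
  rw [draconian_subdiv_snoc_update_iff hadj hvw hb, draconian_subdiv_snoc_update_iff hadj hvw hb,
    and_and_and_comm, ← forall_and]
  refine and_congr (by omega) (forall_congr' fun T => ?_)
  rw [← forall_and]
  refine forall_congr' fun hT => ?_
  obtain ⟨s, t, hs, ht, hsT, htT, h1, h2, h3⟩ :=
    exists_card_insert_closedNbrErase (G := G) hvw hT
  rcases T.eq_empty_or_nonempty with rfl | hTn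
  · simp [closedNbrErase_empty, Finset.card_pair hvw]
  · by_cases hv : v ∈ T <;> by_cases hw : w ∈ T <;>
      simp only [h1, h2, h3, hv, hw, hTn, if_true, if_false, forall_const] at hsT htT ⊢ <;>
      omega

lemma draconian_fiber_zero_of_nbr_eq_singleton (h3 : 3 ≤ N) (hN : nbr G u = {w, w}) :
    {b : Fin N → ℕ | b u = 0 ∧ draconian G (Function.update b u 0)} =
    sumBounded u (N - 2 + 1) fun T =>
      (closedNbrErase G u T).card + if w ∈ T then 1 else 0 := by
  ext b
  refine and_congr_right fun hb => ?_
  rw [draconian_update_iff hN hb]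
  refine and_congr (by omega) (forall_congr' fun T => forall_congr' fun hT => ?_)
  have h := Finset.card_le_card (Finset.subset_insert w (closedNbrErase G u T))
  rcases T.eq_empty_or_nonempty with rfl | hTn
  · simp
  · by_cases hw : w ∈ T
    · simp [hw, hTn]
      omega
    · simp [hw, hTn]
      omega

lemma draconian_fiber_one_of_nbr_eq_singleton (h3 : 3 ≤ N) (hN : nbr G u = {w, w}) :
    {b : Fin N → ℕ | b u = 0 ∧ draconian G (Function.update b u 1)} =
    sumBounded u (N - 2) fun T => (closedNbrErase G u T).card := by
  ext b
  refine and_congr_right fun hb => ?_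
  rw [draconian_update_iff hN hb]
  refine and_congr (by omega) (forall_congr' fun T => forall_congr' fun hT => ?_)
  have h := Finset.card_le_card (Finset.subset_insert w (closedNbrErase G u T))
  rcases T.eq_empty_or_nonempty with rfl | hTn
  · simp
  · by_cases hw : w ∈ T
    · simp [hw, hTn, mem_closedNbrErase_of_mem hT hw]
      omega
    · simp [hw, hTn]
      omega

lemma draconian.lt_card_closedNbr_singleton {a : Fin N → ℕ} (ha : draconian G a) (i : Fin N) :
    a i < (closedNbr G {i}).card := by
  simpa using (draconian_iff_closedNbr.1 ha).2 {i} (by simp)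

lemma card_closedNbr_singleton (i : Fin N) : (closedNbr G {i}).card = (nbr G i).card + 1 := by
  rw [← Finset.card_insert_of_notMem (a := i) (by simp [nbr])]
  congr 1
  ext j
  simp [mem_closedNbr, nbr]

lemma ncard_draconian_eq_three_fibers (hN : (nbr G u).card = 2) :
    {a | draconian G a}.ncard =
      {b | b u = 0 ∧ draconian G (Function.update b u 0)}.ncard +
      {b | b u = 0 ∧ draconian G (Function.update b u 1)}.ncard +
      {b | b u = 0 ∧ draconian G (Function.update b u 2)}.ncard := by
  rw [ncard_eq_sum_ncard_update (finite_setOf_draconian G) u 3]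
  · simp [Finset.sum_range_succ]
  · intro a ha
    have h := draconian.lt_card_closedNbr_singleton ha u
    rwa [card_closedNbr_singleton, hN] at h

/-- If `u` is a leaf, attached at `w`, the draconian sequences of `G` are twice as many as
those of `G` with `u` removed. -/
lemma ncard_draconian_of_nbr_eq_singleton (h3 : 3 ≤ N) (hN : nbr G u = {w, w}) (hw : w ≠ u)
    (hne : ∃ v, v ≠ u ∧ v ≠ w) :
    {a | draconian G a}.ncard =
      2 * (sumBounded u (N - 2) fun T => (closedNbrErase G u T).card).ncard := by
  rw [ncard_eq_sum_ncard_update (finite_setOf_draconian G) u 2]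
  · simp only [Finset.sum_range_succ, Finset.sum_range_zero, zero_add, Set.mem_ofPred]
    rw [draconian_fiber_zero_of_nbr_eq_singleton h3 hN,
      draconian_fiber_one_of_nbr_eq_singleton h3 hN, ncard_sumBounded_add_ite hw _ _ hne, two_mul]
    exact (card_closedNbrErase_le _).trans (by omega)
  · intro a ha
    have h := draconian.lt_card_closedNbr_singleton ha u
    rwa [card_closedNbr_singleton, hN, Finset.pair_eq_singleton, Finset.card_singleton] at h

lemma ncard_draconian_subdiv_eq_sum (hN : ∀ i, G.Adj u i ↔ i = v ∨ i = w) (hvw : v ≠ w) :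
    {a | draconian (subdiv G u v) a}.ncard =
      ∑ q ∈ Finset.range 3, ∑ p ∈ Finset.range 3,
        {b : Fin N → ℕ | b u = 0 ∧
          draconian (subdiv G u v) (Fin.snoc (Function.update b u p) q)}.ncard := by
  have hfin := finite_setOf_draconian (subdiv G u v)
  rw [ncard_eq_sum_ncard_snoc hfin 3]
  · refine Finset.sum_congr rfl fun q _ => ?_
    have hinj : Function.Injective fun b : Fin N → ℕ => (Fin.snoc b q : Fin (N + 1) → ℕ) :=
      fun _ _ h => (Fin.snoc_inj.1 h).1
    refine (ncard_eq_sum_ncard_update (hfin.preimage hinj.injOn) u 3 ?_).trans ?_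
    · intro b hb
      have h := draconian.lt_card_closedNbr_singleton hb u.castSucc
      have hcard := closedNbr_subdiv_insert_left_card hN hvw (Finset.notMem_empty u)
      simp only [Fin.snoc_castSucc] at h
      simp [closedNbrErase_empty] at hcard
      rwa [hcard] at h
    · rfl
  · intro a ha
    have h := draconian.lt_card_closedNbr_singleton ha (Fin.last N)
    have hcard := closedNbr_subdiv_insert_last_card hN (Finset.notMem_empty u)
    simp [closedNbrErase_empty] at hcard
    rwa [hcard] at h

lemma ncard_subdiv_fiber_zero_zero (h3 : 3 ≤ N) (hN : nbr G u = {v, w}) (hvw : v ≠ w)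
    (hvu : v ≠ u) (hwu : w ≠ u) :
    {b : Fin N → ℕ | b u = 0 ∧
      draconian (subdiv G u v) (Fin.snoc (Function.update b u 0) 0)}.ncard =
    (sumBounded u (N - 2) fun T => (closedNbrErase G u T).card).ncard := by
  rw [subdiv_fiber_zero_zero h3 hN hvw, ncard_sumBounded_add_ite hwu _ _ ⟨v, hvu, hvw⟩,
    ncard_sumBounded_add_ite hvu _ _ ⟨w, hwu, hvw.symm⟩]
  · exact (card_closedNbrErase_le _).trans (by omega)
  · have := card_closedNbrErase_le (G := G) (u := u) ((Finset.univ.erase u).erase w)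
    split_ifs <;> omega

end

/-- (Subdivision recurrence) Let `G` be `2`-connected on `[N]` with an edge `e = uv` such
that `deg_G(u) = 2`. Then `|𝔇(G:e)| = 2·|𝔇(G)| + |𝔇(G∖e)|`; consequently
`NVol(∇^PQ_{G:e}) = 2·NVol(∇^PQ_G) + NVol(∇^PQ_{G∖e})`. -/
theorem subdivision_recurrence {N : ℕ} (G : SimpleGraph (Fin N)) (h2 : TwoConnected G)
    (u v : Fin N) (he : G.Adj u v) (hdeg : (nbr G u).card = 2) :
    {a : Fin (N + 1) → ℕ | draconian (subdiv G u v) a}.ncard =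
      2 * {a : Fin N → ℕ | draconian G a}.ncard +
        {a : Fin N → ℕ | draconian (G.deleteEdges {s(u, v)}) a}.ncard := by
  obtain ⟨w, hvw, hN⟩ : ∃ w, v ≠ w ∧ nbr G u = {v, w} := by
    obtain ⟨x, y, hxy, hxy'⟩ := Finset.card_eq_two.1 hdeg
    have hv : v ∈ nbr G u := by simpa [nbr] using he
    rw [hxy', Finset.mem_insert, Finset.mem_singleton] at hv
    rcases hv with rfl | rfl
    · exact ⟨y, hxy, hxy'⟩
    · exact ⟨x, hxy.symm, by rw [hxy', Finset.pair_comm]⟩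
  have hadj : ∀ i, G.Adj u i ↔ i = v ∨ i = w := fun i => by
    simpa [nbr] using Finset.ext_iff.1 hN i
  have hvu : v ≠ u := ((hadj v).2 (.inl rfl)).ne'
  have hwu : w ≠ u := ((hadj w).2 (.inr rfl)).ne'
  have h3 := h2.1
  have hdel : {a : Fin N → ℕ | draconian (G.deleteEdges {s(u, v)}) a}.ncard =
      2 * (sumBounded u (N - 2) fun T => (closedNbrErase G u T).card).ncard := by
    rw [ncard_draconian_of_nbr_eq_singleton h3 (nbr_deleteEdges hN hvw) hwu ⟨v, hvu, hvw⟩]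
    congr 2
    ext b
    refine and_congr_right fun _ => and_congr_right fun _ => forall_congr' fun T =>
      forall_congr' fun hT => ?_
    simp only [closedNbrErase_deleteEdges hT]
  have hfin : ∀ p q, {b : Fin N → ℕ | b u = 0 ∧
      draconian (subdiv G u v) (Fin.snoc (Function.update b u p) q)}.Finite := by
    intro p q
    refine (Set.finite_Iic (fun _ : Fin N => N)).subset fun b hb i => ?_
    have h := ((draconian_subdiv_snoc_update_iff hadj hvw hb.1 p q).1 hb.2).1
    have := Finset.single_le_sum (f := b) (fun _ _ => Nat.zero_le _) (Finset.mem_univ i)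
    show b i ≤ N
    omega
  have hunion := Set.ncard_union_add_ncard_inter _ _ (hfin 0 2) (hfin 2 0)
  rw [subdiv_fiber_union h3 hN hvw, subdiv_fiber_inter h3 hN hvw] at hunion
  rw [ncard_draconian_subdiv_eq_sum hadj hvw, ncard_draconian_eq_three_fibers hdeg, hdel]
  simp only [Finset.sum_range_succ, Finset.sum_range_zero, zero_add]
  rw [ncard_subdiv_fiber_zero_zero h3 hN hvw hvu hwu, subdiv_fiber_two_two hN hvw,
    subdiv_fiber_eq_fiber (p := 1) (q := 0) (r := 0) h3 hN hvw (by simp) (by simp) (by simp),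
    subdiv_fiber_eq_fiber (p := 0) (q := 1) (r := 0) h3 hN hvw (by simp) (by simp) (by simp),
    subdiv_fiber_eq_fiber (p := 1) (q := 1) (r := 1) h3 hN hvw (by simp) (by simp) (by simp),
    subdiv_fiber_eq_fiber (p := 2) (q := 1) (r := 2) h3 hN hvw (by simp) (by simp) (by simp),
    subdiv_fiber_eq_fiber (p := 1) (q := 2) (r := 2) h3 hN hvw (by simp) (by simp) (by simp),
    Set.ncard_empty]
  omega
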